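/- arXiv:1911.03827 — 2 statements merged into one kernel-verified Lean document; each statement's English description precedes it below -/
import Mathlib

section
/- Let E be a real vector space, let f : E → ℝ be nonnegative with a global minimizer v (f(v) ≤ f(x) for all x), and let c : E → E → ℝ be nonnegative and satisfy Condition II with parameter η ≥ 1. Then for all points a, b, q ∈ E: f(v) + c(v, q) ≤ f(a) + ((η² + η)/2)·c(v, a) + η²·c(a, b) + ((η² + η)/2)·c(b, q). -/
/-- **Per-step estimate for the greedy algorithm (eq. (8)).** If `f` is nonnegative
with global minimizer `v` and the nonnegative movement cost `c` satisfies the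
approximate triangle inequality with parameter `η ≥ 1`, then for all `a b q`,
`f(v) + c(v, q) ≤ f(a) + ((η² + η)/2)·c(v, a) + η²·c(a, b) + ((η² + η)/2)·c(b, q)`. -/
theorem greedy_step_bound {E : Type*} [AddCommGroup E] [Module ℝ E]
    (f : E → ℝ) (c : E → E → ℝ) (v : E) (η : ℝ) (heta : 1 ≤ η)
    (hf : ∀ x, 0 ≤ f x)
    (hc : ∀ x y, 0 ≤ c x y)
    (hmin : ∀ x, f v ≤ f x)
    (hII : ∀ x y z, c x z ≤ η * (c x y + c y z)) :
    ∀ a b q : E, f v + c v q ≤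
      f a + ((η ^ 2 + η) / 2) * c v a + η ^ 2 * c a b + ((η ^ 2 + η) / 2) * c b q := by
  intro a b q
  have hη : 0 ≤ η := zero_le_one.trans heta
  -- Average the two ways of splitting `v → a → b → q`: first at `a`, or first at `b`.
  have via_a : c v q ≤ η * (c v a + η * (c a b + c b q)) :=
    (hII v a q).trans (by gcongr; exact hII a b q)
  have via_b : c v q ≤ η * (η * (c v a + c a b) + c b q) :=
    (hII v b q).trans (by gcongr; exact hII v a b)
  linarith [hmin a]
end

section
/- Let d ∈ ℕ and let e, β ∈ ℝ^d have strictly positive entries (e_s > 0 and β_s > 0 for all s). Let F = {x ∈ ℝ^d : x_s ≥ 0 for all s} be the nonnegative orthant and define the movement cost c(x, y) = Σ_{s=1}^d β_s·max(x_s − y_s, 0). Suppose f : ℝ^d → ℝ satisfies f(x) ≥ Σ_{s=1}^d e_s·x_s for all x ∈ F, and let v ∈ F be a minimizer of f over F (f(v) ≤ f(x) for all x ∈ F). Then for all x ∈ F: f(x) ≥ (1/2)·(min_{1 ≤ s ≤ d} e_s/β_s)·(c(x, v) + c(v, x)). That is, the geographical load balancing model satisfies Condition I with λ = (1/2)·min_s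 e_s/β_s (and its movement cost satisfies Condition II with η = 1). -/
open Finset

/-- The switching cost of the geographical load balancing model:
`c(x, y) = Σ_s β_s · max(x_s − y_s, 0)`. -/
def glbCost {d : ℕ} (β : Fin d → ℝ) (x y : Fin d → ℝ) : ℝ :=
  ∑ s, β s * max (x s - y s) 0

/-- If `m * β s ≤ e s` for every `s`, then on the nonnegative orthant `m` times the cost of
switching to `x` is at most the operating cost `e·x`. -/
lemma mul_glbCost_le {d : ℕ} {e β x y : Fin d → ℝ} {m : ℝ} (he : ∀ s, 0 ≤ e s)
    (hm : ∀ s, m * β s ≤ e s) (hx : ∀ s, 0 ≤ x s) (hy : ∀ s, 0 ≤ y s) :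
    m * glbCost β x y ≤ ∑ s, e s * x s := by
  rw [glbCost, Finset.mul_sum]
  refine Finset.sum_le_sum fun s _ => ?_
  have hmax : max (x s - y s) 0 ≤ x s := max_le (sub_le_self _ (hy s)) (hx s)
  calc m * (β s * max (x s - y s) 0) = m * β s * max (x s - y s) 0 := by ring
    _ ≤ e s * max (x s - y s) 0 := mul_le_mul_of_nonneg_right (hm s) (le_max_right _ _)
    _ ≤ e s * x s := mul_le_mul_of_nonneg_left hmax (he s)

/-- The switching cost satisfies the triangle inequality. -/
lemma glbCost_triangle {d : ℕ} {β : Fin d → ℝ} (hβ : ∀ s, 0 ≤ β s) (x y z : Fin d → ℝ) :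
    glbCost β x z ≤ glbCost β x y + glbCost β y z := by
  simp only [glbCost, ← Finset.sum_add_distrib, ← mul_add]
  refine Finset.sum_le_sum fun s _ => mul_le_mul_of_nonneg_left (max_le ?_ (by positivity)) (hβ s)
  linarith [le_max_left (x s - y s) 0, le_max_left (y s - z s) 0]

/-- **Appendix C (connection to Lin et al.).** In the geographical load balancing
model, with `e, β > 0` componentwise, feasible set the nonnegative orthant `F`,
hitting cost satisfying `f(x) ≥ e·x` on `F`, switching cost
`c(x, y) = β·(x − y)⁺`, and `v` a minimizer of `f` over `F`, Condition I holds
with `λ = (1/2)·min_s e_s/β_s`, and the switching cost satisfies Condition II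
with `η = 1`. -/
theorem glb_satisfies_conditions (d : ℕ) (hd : 0 < d)
    (e β : Fin d → ℝ) (he : ∀ s, 0 < e s) (hβ : ∀ s, 0 < β s)
    (f : (Fin d → ℝ) → ℝ)
    (hf : ∀ x : Fin d → ℝ, (∀ s, 0 ≤ x s) → ∑ s, e s * x s ≤ f x)
    (v : Fin d → ℝ) (hv : ∀ s, 0 ≤ v s)
    (hvmin : ∀ x : Fin d → ℝ, (∀ s, 0 ≤ x s) → f v ≤ f x) :
    (∀ x : Fin d → ℝ, (∀ s, 0 ≤ x s) →
      (1 / 2) * (⨅ s : Fin d, e s / β s) * (glbCost β x v + glbCost β v x) ≤ f x) ∧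
    (∀ x y z : Fin d → ℝ, glbCost β x z ≤ 1 * (glbCost β x y + glbCost β y z)) := by
  have hm : ∀ s, (⨅ s : Fin d, e s / β s) * β s ≤ e s := fun s =>
    (le_div_iff₀ (hβ s)).1 (ciInf_le (Set.finite_range _).bddBelow s)
  have he' : ∀ s, 0 ≤ e s := fun s => (he s).le
  refine ⟨fun x hx => ?_, fun x y z => ?_⟩
  · have hxv := (mul_glbCost_le he' hm hx hv).trans (hf x hx)
    have hvx := ((mul_glbCost_le he' hm hv hx).trans (hf v hv)).trans (hvmin x hx)
    linarith
  · rw [one_mul]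
    exact glbCost_triangle (fun s => (hβ s).le) x y z
end
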